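/- Let m ≥ 1 and let f : ℍ^m → ℍ^m be an ℍ-linear endomorphism of the quaternion module ℍ^m. Then the determinant of f, regarded (by restriction of scalars) as an ℝ-linear endomorphism of the 4m-dimensional real vector space underlying ℍ^m, is nonnegative. -/

import Mathlib

open scoped Quaternion

/-- An `ℝ`-linear map that commutes with a compatible complex structure has nonnegative real
determinant, namely the squared norm of its complex determinant. -/
theorem LinearMap.det_restrictScalars_complex_nonneg {V : Type*} [AddCommGroup V] [Module ℝ V]
    [Module ℂ V] [IsScalarTower ℝ ℂ V] (g : V →ₗ[ℂ] V) :
    0 ≤ LinearMap.det (g.restrictScalars ℝ) := by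
  rw [LinearMap.det_restrictScalars, Algebra.norm_complex_apply]
  exact Complex.normSq_nonneg _

/-- Let `m ≥ 1` and let `f : ℍ^m → ℍ^m` be an `ℍ`-linear endomorphism of the quaternion
module `ℍ^m`.  Then the determinant of `f`, regarded (by restriction of scalars) as an
`ℝ`-linear endomorphism of the `4m`-dimensional real vector space underlying `ℍ^m`,
is nonnegative.  (Formalizable core of Theorem 2.1.3.7 on orientability of quaternion
manifolds.) -/
theorem quaternion_linear_det_nonneg (m : ℕ) (hm : 1 ≤ m)
    (f : (Fin m → ℍ[ℝ]) →ₗ[ℍ[ℝ]] (Fin m → ℍ[ℝ])) :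
    0 ≤ LinearMap.det (f.restrictScalars ℝ) := by
  let : Module ℂ (Fin m → ℍ[ℝ]) := Module.compHom _ Quaternion.ofComplex.toRingHom
  have hsmul (c : ℂ) (v : Fin m → ℍ[ℝ]) : c • v = Quaternion.ofComplex c • v := rfl
  have : IsScalarTower ℝ ℂ (Fin m → ℍ[ℝ]) :=
    ⟨fun r c v => by rw [hsmul, hsmul, map_smul, smul_assoc]⟩
  let g : (Fin m → ℍ[ℝ]) →ₗ[ℂ] (Fin m → ℍ[ℝ]) :=
    { f with map_smul' := fun c v => f.map_smul (Quaternion.ofComplex c) v }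
  exact g.det_restrictScalars_complex_nonneg
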